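/- arXiv:1209.0002 — 5 statements merged into one kernel-verified Lean document; each statement's English description precedes it below -/
import Mathlib

section
/- Let A, W ∈ SL(2,ℂ) and let l₁, l₂ be lists of elements of SL(2,ℂ) each of whose entries equals A, A⁻¹, W, or W⁻¹. Then tr((l₁ ++ l₂).prod) = tr((l₁.reverse ++ l₂.reverse).prod); i.e., for words u, v in A, W and their inverses, the trace of u·v equals the trace of (reverse of u)·(reverse of v). -/
/-- The trace of an element of `SL(2,ℂ)`, i.e. the trace of the underlying matrix. -/
noncomputable def tr (A : Matrix.SpecialLinearGroup (Fin 2) ℂ) : ℂ :=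
  Matrix.trace (A : Matrix (Fin 2) (Fin 2) ℂ)

/-- `x` and `y` are the combinations of `1, a, w, a * w` and of `1, a, w, w * a` respectively
with the same coefficients. -/
def IsReversePair (K : Type*) {R : Type*} [CommRing K] [Ring R] [Algebra K R]
    (a w x y : R) : Prop :=
  ∃ k₀ k₁ k₂ k₃ : K, x = k₀ • (1 : R) + k₁ • a + k₂ • w + k₃ • (a * w) ∧
    y = k₀ • (1 : R) + k₁ • a + k₂ • w + k₃ • (w * a)

namespace IsReversePair

variable {K R : Type*} [CommRing K] [Ring R] [Algebra K R] {a w x y x' y' : R}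

lemma one (a w : R) : IsReversePair K a w 1 1 :=
  ⟨1, 0, 0, 0, by simp, by simp⟩

lemma smul_sub (h : IsReversePair K a w x y) (h' : IsReversePair K a w x' y') (s : K) :
    IsReversePair K a w (s • x - x') (s • y - y') := by
  obtain ⟨k₀, k₁, k₂, k₃, rfl, rfl⟩ := h
  obtain ⟨m₀, m₁, m₂, m₃, rfl, rfl⟩ := h'
  exact ⟨s * k₀ - m₀, s * k₁ - m₁, s * k₂ - m₂, s * k₃ - m₃, by module, by module⟩

lemma mul_first {t : K} (ha : a * a = t • a - 1) (h : IsReversePair K a w x y) :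
    IsReversePair K a w (a * x) (y * a) := by
  obtain ⟨k₀, k₁, k₂, k₃, rfl, rfl⟩ := h
  refine ⟨-k₁, k₀ + t * k₁, -k₃, k₂ + t * k₃, ?_, ?_⟩
  · simp only [mul_add, mul_smul_comm, mul_one, ← mul_assoc, ha, sub_mul, smul_mul_assoc, one_mul]
    module
  · simp only [add_mul, smul_mul_assoc, one_mul, mul_assoc, ha, mul_sub, mul_smul_comm, mul_one]
    module

lemma mul_second {s t c : K} (hw : w * w = s • w - 1)
    (hwa : w * a = s • a + t • w + c • (1 : R) - a * w) (h : IsReversePair K a w x y) :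
    IsReversePair K a w (w * x) (y * w) := by
  obtain ⟨k₀, k₁, k₂, k₃, rfl, rfl⟩ := h
  have haw : a * w = s • a + t • w + c • (1 : R) - w * a := by rw [hwa]; abel
  have hwaw : w * a * w = a + c • w + t • (s • w - 1) := by
    rw [hwa]
    simp only [sub_mul, add_mul, smul_mul_assoc, one_mul, mul_assoc, hw, mul_sub, mul_smul_comm,
      mul_one]
    module
  refine ⟨c * k₁ - k₂ - t * k₃, s * k₁ + k₃, k₀ + t * k₁ + s * k₂ + (c + t * s) * k₃, -k₁, ?_, ?_⟩
  · simp only [mul_add, mul_smul_comm, mul_one, ← mul_assoc, hwaw, hw]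
    rw [hwa]
    module
  · simp only [add_mul, smul_mul_assoc, one_mul, hwaw, hw]
    rw [haw]
    module

end IsReversePair

namespace Matrix.SpecialLinearGroup

variable {K : Type*} [CommRing K] (A W : SpecialLinearGroup (Fin 2) K)

lemma coe_inv_eq_trace_smul_sub :
    ((A⁻¹ : SpecialLinearGroup (Fin 2) K) : Matrix (Fin 2) (Fin 2) K) =
      A.1.trace • (1 : Matrix (Fin 2) (Fin 2) K) - A.1 := by
  rw [coe_inv, adjugate_fin_two]
  ext i j
  fin_cases i <;> fin_cases j <;> simp [trace_fin_two]

lemma coe_mul_self_eq : A.1 * A.1 = A.1.trace • A.1 - 1 := by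
  have h : A.1 * (A⁻¹ : SpecialLinearGroup (Fin 2) K).1 = 1 := by
    rw [← coe_mul, mul_inv_cancel, coe_one]
  rw [coe_inv_eq_trace_smul_sub, mul_sub, mul_smul_comm, mul_one] at h
  rw [← h]
  abel

lemma isReversePair_prod (l : List (SpecialLinearGroup (Fin 2) K))
    (hl : ∀ g ∈ l, g = A ∨ g = A⁻¹ ∨ g = W ∨ g = W⁻¹) :
    IsReversePair K A.1 W.1 l.prod.1 l.reverse.prod.1 := by
  induction l with
  | nil => simpa using IsReversePair.one A.1 W.1
  | cons g l ih =>
    have h := ih fun x hx => hl x (List.mem_cons_of_mem g hx)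
    have hWA : W.1 * A.1 = W.1.trace • A.1 + A.1.trace • W.1 +
        ((A.1 * W.1).trace - A.1.trace * W.1.trace) • (1 : Matrix (Fin 2) (Fin 2) K) -
          A.1 * W.1 := by
      ext i j
      fin_cases i <;> fin_cases j <;> simp [trace_fin_two, mul_apply, Fin.sum_univ_two] <;> ring
    have hA := h.mul_first A.coe_mul_self_eq
    have hW := h.mul_second W.coe_mul_self_eq hWA
    simp only [List.prod_cons, List.reverse_cons, List.prod_append, List.prod_nil, mul_one, coe_mul]
    rcases hl g List.mem_cons_self with rfl | rfl | rfl | rfl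
    · exact hA
    · simpa only [coe_inv_eq_trace_smul_sub, sub_mul, mul_sub, smul_mul_assoc, mul_smul_comm,
        one_mul, mul_one] using h.smul_sub hA A.1.trace
    · exact hW
    · simpa only [coe_inv_eq_trace_smul_sub, sub_mul, mul_sub, smul_mul_assoc, mul_smul_comm,
        one_mul, mul_one] using h.smul_sub hW W.1.trace

end Matrix.SpecialLinearGroup

lemma tr_mul_comm (A B : Matrix.SpecialLinearGroup (Fin 2) ℂ) : tr (A * B) = tr (B * A) := by
  simp only [tr, Matrix.SpecialLinearGroup.coe_mul, Matrix.trace_mul_comm A.1]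

/-- For words `u`, `v` in `A`, `W` and their inverses, the trace of `u * v` equals the
trace of `(reverse of u) * (reverse of v)`. -/
theorem trace_append_eq_trace_reverse_append (A W : Matrix.SpecialLinearGroup (Fin 2) ℂ)
    (l₁ l₂ : List (Matrix.SpecialLinearGroup (Fin 2) ℂ))
    (hl₁ : ∀ g ∈ l₁, g = A ∨ g = A⁻¹ ∨ g = W ∨ g = W⁻¹)
    (hl₂ : ∀ g ∈ l₂, g = A ∨ g = A⁻¹ ∨ g = W ∨ g = W⁻¹) :
    tr (l₁ ++ l₂).prod = tr (l₁.reverse ++ l₂.reverse).prod := by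
  rw [List.prod_append (l₁ := l₁.reverse), tr_mul_comm, ← List.prod_append, ← List.reverse_append]
  obtain ⟨k₀, k₁, k₂, k₃, h, h'⟩ := Matrix.SpecialLinearGroup.isReversePair_prod A W (l₁ ++ l₂)
    fun g hg => (List.mem_append.mp hg).elim (hl₁ g) (hl₂ g)
  simp only [tr, h, h', Matrix.trace_add, Matrix.trace_smul, Matrix.trace_mul_comm A.1]
end

section
/- Let a, w be the two generators of the free group F = FreeGroup (Fin 2), and let P : F → MvPolynomial (Fin 3) ℂ satisfy: for every pair A, B ∈ SL(2,ℂ) and every g ∈ F, evaluating P g at (tr A, tr B, tr (A·B)) equals tr(ρ g), where ρ : F → SL(2,ℂ) is the homomorphism with ρ a = A and ρ w = B. Then for all u, v ∈ F and every g ∈ F, the polynomial P(u·g) − P(v·g) lies in the ideal of MvPolynomial (Fin 3) ℂ generated by the five polynomials P u − P v, P(u·a) − P(v·a), P(u·w) − P(v·w), P(u·a·w) − P(v·a·w), and P(u·w·a) − P(v·w·a). -/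
open Matrix MvPolynomial

/-- Every triple of complex numbers is the triple of traces of a pair in `SL(2,ℂ)`. -/
theorem exists_tr_eq (x y z : ℂ) :
    ∃ A B : SpecialLinearGroup (Fin 2) ℂ, tr A = x ∧ tr B = y ∧ tr (A * B) = z := by
  obtain ⟨s, hs⟩ := IsAlgClosed.exists_pow_nat_eq (z ^ 2 - 4) (n := 2) (by norm_num)
  obtain ⟨t, r, hsum, hprod⟩ : ∃ t r : ℂ, t + r = z ∧ t * r = 1 :=
    ⟨(z + s) / 2, (z - s) / 2, by ring, by linear_combination -hs / 4⟩
  refine ⟨⟨!![x, -1; 1, 0], by simp⟩, ⟨!![0, t; -r, y], by simpa using hprod⟩, ?_, ?_, ?_⟩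
  · simp [tr]
  · simp [tr]
  · change trace (!![x, -1; 1, 0] * !![0, t; -r, y]) = z
    simp [trace_fin_two, ← hsum, add_comm]

/-- The fundamental trace identity in `SL(2,ℂ)`. -/
theorem tr_mul_inv_mul (H A K : SpecialLinearGroup (Fin 2) ℂ) :
    tr (H * A⁻¹ * K) = tr A * tr (H * K) - tr (H * A * K) := by
  change trace (H.1 * adjugate A.1 * K.1) =
    trace A.1 * trace (H.1 * K.1) - trace (H.1 * A.1 * K.1)
  rw [adjugate_fin_two]
  simp only [trace_fin_two, Matrix.mul_apply, Fin.sum_univ_two, of_apply, cons_val', cons_val_zero,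
    cons_val_one]
  simp
  ring

/-- A map with the values of a trace polynomial satisfies the fundamental trace identity. -/
theorem trace_poly_mul_inv_mul {P : FreeGroup (Fin 2) → MvPolynomial (Fin 3) ℂ}
    (hP : ∀ (A B : SpecialLinearGroup (Fin 2) ℂ) (g : FreeGroup (Fin 2)),
      eval ![tr A, tr B, tr (A * B)] (P g) = tr (FreeGroup.lift ![A, B] g))
    (h g k : FreeGroup (Fin 2)) :
    P (h * g⁻¹ * k) = P g * P (h * k) - P (h * g * k) := by
  refine MvPolynomial.funext fun p => ?_
  obtain ⟨A, B, hA, hB, hAB⟩ := exists_tr_eq (p 0) (p 1) (p 2)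
  obtain rfl : ![tr A, tr B, tr (A * B)] = p := by
    ext i
    fin_cases i <;> simp [hA, hB, hAB]
  simp only [map_sub, map_mul, map_inv, hP, tr_mul_inv_mul]

section TraceIdentity

variable {G R : Type*} [Group G] [CommRing R] {f : G → R}

theorem trace_mul_self_mul
    (hf : ∀ h g k, f (h * g⁻¹ * k) = f g * f (h * k) - f (h * g * k))
    (h g k : G) :
    f (h * g * g * k) = f g * f (h * g * k) - f (h * k) := by
  have := hf (h * g) g k
  rw [mul_inv_cancel_right] at this
  linear_combination this

theorem trace_mul_swap_mul
    (hf : ∀ h g k, f (h * g⁻¹ * k) = f g * f (h * k) - f (h * g * k))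
    (h a w k : G) :
    f (h * w * a * k) = f a * f (h * w * k) + f w * f (h * a * k)
      + (f (a * w) - f a * f w) * f (h * k) - f (h * a * w * k) := by
  have h₁ := hf h (a * w) k
  have h₂ := hf (h * w⁻¹) a k
  have h₃ := hf h w k
  have h₄ := hf h w (a * k)
  simp only [_root_.mul_inv_rev, ← mul_assoc] at h₁ h₂ h₃ h₄
  linear_combination h₁ - h₂ - f a * h₃ + h₄

/-- `g` acts on the right as a combination of `1`, `a`, `w`, `a * w`, as far as `f` can see. -/
def IsTraceCombination (f : G → R) (a w g : G) : Prop :=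
  ∃ c₀ c₁ c₂ c₃ : R, ∀ h, f (h * g) =
    c₀ * f h + c₁ * f (h * a) + c₂ * f (h * w) + c₃ * f (h * a * w)

theorem IsTraceCombination.inv_mul {a w s g : G} (hg : IsTraceCombination f a w g)
    (hf : ∀ h g k, f (h * g⁻¹ * k) = f g * f (h * k) - f (h * g * k))
    (hsg : IsTraceCombination f a w (s * g)) : IsTraceCombination f a w (s⁻¹ * g) := by
  obtain ⟨c₀, c₁, c₂, c₃, hc⟩ := hg
  obtain ⟨d₀, d₁, d₂, d₃, hd⟩ := hsg
  refine ⟨f s * c₀ - d₀, f s * c₁ - d₁, f s * c₂ - d₂, f s * c₃ - d₃, fun h => ?_⟩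
  rw [← mul_assoc, hf, mul_assoc h s g, hc, hd]
  ring

theorem IsTraceCombination.left_mul {a w g : G} (hg : IsTraceCombination f a w g)
    (hf : ∀ h g k, f (h * g⁻¹ * k) = f g * f (h * k) - f (h * g * k)) :
    IsTraceCombination f a w (a * g) := by
  obtain ⟨c₀, c₁, c₂, c₃, hc⟩ := hg
  refine ⟨-c₁, c₀ + f a * c₁, -c₃, c₂ + f a * c₃, fun h => ?_⟩
  have h₁ := trace_mul_self_mul hf h a 1
  have h₂ := trace_mul_self_mul hf h a w
  simp only [mul_one] at h₁
  rw [← mul_assoc, hc, h₁, h₂]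
  ring

theorem IsTraceCombination.right_mul {a w g : G} (hg : IsTraceCombination f a w g)
    (hf : ∀ h g k, f (h * g⁻¹ * k) = f g * f (h * k) - f (h * g * k)) :
    IsTraceCombination f a w (w * g) := by
  obtain ⟨c₀, c₁, c₂, c₃, hc⟩ := hg
  refine ⟨(f (a * w) - f a * f w) * c₁ - c₂ - f a * c₃, f w * c₁ + c₃,
    c₀ + f a * c₁ + f w * c₂ + f (a * w) * c₃, -c₁, fun h => ?_⟩
  have h₁ := trace_mul_swap_mul hf h a w 1
  have h₂ := trace_mul_self_mul hf h w 1
  have h₃ := trace_mul_swap_mul hf h a w w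
  have h₄ := trace_mul_self_mul hf (h * a) w 1
  simp only [mul_one] at h₁ h₂ h₄
  rw [← mul_assoc, hc, h₁, h₃, h₄, h₂]
  ring

end TraceIdentity

theorem isTraceCombination_freeGroup {R : Type*} [CommRing R] {f : FreeGroup (Fin 2) → R}
    (hf : ∀ h g k, f (h * g⁻¹ * k) = f g * f (h * k) - f (h * g * k))
    (g : FreeGroup (Fin 2)) :
    IsTraceCombination f (FreeGroup.of 0) (FreeGroup.of 1) g := by
  have hof (i : Fin 2) (k : FreeGroup (Fin 2))
      (hk : IsTraceCombination f (FreeGroup.of 0) (FreeGroup.of 1) k) :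
      IsTraceCombination f (FreeGroup.of 0) (FreeGroup.of 1) (FreeGroup.of i * k) := by
    fin_cases i
    · exact hk.left_mul hf
    · exact hk.right_mul hf
  suffices hmul : ∀ k, IsTraceCombination f (FreeGroup.of 0) (FreeGroup.of 1) k →
      IsTraceCombination f (FreeGroup.of 0) (FreeGroup.of 1) (g * k) by
    simpa using hmul 1 ⟨1, 0, 0, 0, by simp⟩
  induction g using FreeGroup.induction_on with
  | C1 => simp
  | of i => exact hof i
  | inv_of i _ => exact fun k hk => hk.inv_mul hf (hof i k hk)
  | mul x y hx hy => exact fun k hk => mul_assoc x y k ▸ hx _ (hy _ hk)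

/-- Let `a`, `w` be the two generators of `FreeGroup (Fin 2)` and let `P` be the
trace-polynomial map: for every `A, B ∈ SL(2,ℂ)` and every `g`, evaluating `P g` at
`(tr A, tr B, tr (A*B))` gives the trace of `ρ g` where `ρ` sends `a ↦ A`, `w ↦ B`.
Then `P (u*g) - P (v*g)` lies in the ideal generated by the five polynomials
`P u - P v`, `P (u*a) - P (v*a)`, `P (u*w) - P (v*w)`, `P (u*a*w) - P (v*a*w)` and
`P (u*w*a) - P (v*w*a)`. -/
theorem trace_poly_diff_mem_span (P : FreeGroup (Fin 2) → MvPolynomial (Fin 3) ℂ)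
    (hP : ∀ (A B : Matrix.SpecialLinearGroup (Fin 2) ℂ) (g : FreeGroup (Fin 2)),
      MvPolynomial.eval ![tr A, tr B, tr (A * B)] (P g) = tr (FreeGroup.lift ![A, B] g))
    (u v g : FreeGroup (Fin 2)) :
    letI a : FreeGroup (Fin 2) := FreeGroup.of 0
    letI w : FreeGroup (Fin 2) := FreeGroup.of 1
    P (u * g) - P (v * g) ∈ Ideal.span
      {P u - P v, P (u * a) - P (v * a), P (u * w) - P (v * w),
        P (u * a * w) - P (v * a * w), P (u * w * a) - P (v * w * a)} := by
  obtain ⟨c₀, c₁, c₂, c₃, hc⟩ := isTraceCombination_freeGroup (trace_poly_mul_inv_mul hP) g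
  have hdiff : P (u * g) - P (v * g) = c₀ * (P u - P v)
      + c₁ * (P (u * FreeGroup.of 0) - P (v * FreeGroup.of 0))
      + c₂ * (P (u * FreeGroup.of 1) - P (v * FreeGroup.of 1))
      + c₃ * (P (u * FreeGroup.of 0 * FreeGroup.of 1)
        - P (v * FreeGroup.of 0 * FreeGroup.of 1)) := by
    rw [hc, hc]
    ring
  rw [hdiff]
  refine add_mem (add_mem (add_mem ?_ ?_) ?_) ?_ <;>
    exact Ideal.mul_mem_left _ _ (Ideal.subset_span (by simp))
end

section
/- Let a, w be the two generators of F = FreeGroup (Fin 2), let rev : F → F be the word-reversal anti-automorphism, let r ∈ F, and let G be the presented group with generators a, w and the single relation r = rev r (i.e., PresentedGroup with relator r·(rev r)⁻¹), with projection π : F → G. Let P : F → MvPolynomial (Fin 3) ℂ be the trace-polynomial map. Then the ideal of MvPolynomial (Fin 3) ℂ generated by all differences P u − P v, where u, v ∈ F satisfy π u = π v, equals the principal ideal generated by the single polynomial P(r·a·w) − P((rev r)·a·w). -/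
local notation:1024 "↑ₘ" A:1024 => (A : Matrix (Fin 2) (Fin 2) ℂ)

/-! ### Identities for a pair of matrices in `SL(2,ℂ)` -/

lemma tr_eq (A : Matrix.SpecialLinearGroup (Fin 2) ℂ) : tr A = ↑ₘA 0 0 + ↑ₘA 1 1 :=
  Matrix.trace_fin_two _

/-- Cayley–Hamilton in `SL(2,ℂ)`. -/
lemma coe_mul_self (A : Matrix.SpecialLinearGroup (Fin 2) ℂ) :
    ↑ₘA * ↑ₘA = tr A • ↑ₘA - 1 := by
  have h := A.det_coe
  rw [Matrix.det_fin_two] at h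
  ext i j
  fin_cases i <;> fin_cases j <;>
    simp [tr_eq, Matrix.mul_apply, Fin.sum_univ_two]
  · linear_combination -h
  · ring
  · ring
  · linear_combination -h

lemma coe_inv_eq (A : Matrix.SpecialLinearGroup (Fin 2) ℂ) :
    ↑ₘ(A⁻¹ : Matrix.SpecialLinearGroup (Fin 2) ℂ)
      = tr A • (1 : Matrix (Fin 2) (Fin 2) ℂ) - ↑ₘA := by
  ext i j
  fin_cases i <;> fin_cases j <;>
    simp [tr_eq, Matrix.adjugate_fin_two]

/-- The polarized Cayley–Hamilton identity. -/
lemma coe_mul_swap (A B : Matrix.SpecialLinearGroup (Fin 2) ℂ) :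
    ↑ₘB * ↑ₘA = tr A • ↑ₘB + tr B • ↑ₘA
      + (tr (A * B) - tr A * tr B) • (1 : Matrix (Fin 2) (Fin 2) ℂ) - ↑ₘA * ↑ₘB := by
  ext i j
  fin_cases i <;> fin_cases j <;>
    simp [tr_eq, Matrix.mul_apply, Fin.sum_univ_two] <;> ring

lemma coe_mul_mul_self (A B : Matrix.SpecialLinearGroup (Fin 2) ℂ) :
    ↑ₘB * ↑ₘA * ↑ₘB = ↑ₘA - tr A • (1 : Matrix (Fin 2) (Fin 2) ℂ) + tr (A * B) • ↑ₘB := by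
  rw [coe_mul_swap A B]
  simp only [add_mul, sub_mul, smul_mul_assoc, one_mul, mul_assoc, coe_mul_self B,
    mul_sub, mul_smul_comm, mul_one]
  module

lemma trace_mul_self (A : Matrix.SpecialLinearGroup (Fin 2) ℂ) :
    Matrix.trace (↑ₘA * ↑ₘA) = tr A ^ 2 - 2 := by
  rw [coe_mul_self, Matrix.trace_sub, Matrix.trace_smul, ← tr, Matrix.trace_one]
  simp [sq]

lemma trace_mul_mul_swap (A B : Matrix.SpecialLinearGroup (Fin 2) ℂ) :
    Matrix.trace (↑ₘA * ↑ₘB * (↑ₘB * ↑ₘA))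
      = tr A * tr B * tr (A * B) - tr A ^ 2 - tr B ^ 2 + 2 := by
  have h : ↑ₘA * ↑ₘB * (↑ₘB * ↑ₘA)
      = tr B • (↑ₘA * ↑ₘB * ↑ₘA) - ↑ₘA * ↑ₘA := by
    rw [show ↑ₘA * ↑ₘB * (↑ₘB * ↑ₘA) = ↑ₘA * (↑ₘB * ↑ₘB) * ↑ₘA by simp only [mul_assoc],
      coe_mul_self B]
    simp only [mul_sub, sub_mul, mul_smul_comm, smul_mul_assoc, mul_one]
  have h' : Matrix.trace (↑ₘA * ↑ₘB * ↑ₘA) = tr A * tr (A * B) - tr B := by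
    rw [Matrix.trace_mul_comm, ← mul_assoc, coe_mul_self, sub_mul, smul_mul_assoc, one_mul,
      Matrix.trace_sub, Matrix.trace_smul, ← Matrix.SpecialLinearGroup.coe_mul, ← tr, ← tr,
      smul_eq_mul]
  rw [h, Matrix.trace_sub, Matrix.trace_smul, h', trace_mul_self, smul_eq_mul]
  ring

/-- Every point of `ℂ³` is the character of a pair of matrices in `SL(2,ℂ)`. -/
lemma exists_traces_eq (x : Fin 3 → ℂ) :
    ∃ A B : Matrix.SpecialLinearGroup (Fin 2) ℂ, ![tr A, tr B, tr (A * B)] = x := by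
  obtain ⟨s, hs⟩ := IsAlgClosed.exists_pow_nat_eq (x 2 ^ 2 - 4) (n := 2) (by norm_num)
  set c := (x 2 + s) / 2
  have hc : c * (x 2 - c) = 1 := by
    linear_combination (-1 / 4 : ℂ) * hs
  obtain ⟨A, hA⟩ : ∃ A : Matrix.SpecialLinearGroup (Fin 2) ℂ, ↑ₘA = !![x 0, -1; 1, 0] :=
    ⟨⟨_, by simp⟩, rfl⟩
  obtain ⟨B, hB⟩ : ∃ B : Matrix.SpecialLinearGroup (Fin 2) ℂ,
      ↑ₘB = !![0, c; -(x 2 - c), x 1] :=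
    ⟨⟨_, by rw [Matrix.det_fin_two_of]; linear_combination hc⟩, rfl⟩
  refine ⟨A, B, ?_⟩
  ext i
  fin_cases i <;> simp [tr_eq, hA, hB]

/-- Polynomials agreeing at all characters of pairs of matrices are equal. -/
lemma MvPolynomial.eq_of_eval_traces {p q : MvPolynomial (Fin 3) ℂ}
    (h : ∀ A B : Matrix.SpecialLinearGroup (Fin 2) ℂ,
      MvPolynomial.eval ![tr A, tr B, tr (A * B)] p
        = MvPolynomial.eval ![tr A, tr B, tr (A * B)] q) : p = q :=
  MvPolynomial.funext fun x => by
    obtain ⟨A, B, rfl⟩ := exists_traces_eq x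
    exact h A B

/-! ### Coordinates of words in the basis `1, a, w, aw` -/

/-- The polynomials `c 0, c 1, c 2, c 3` are coordinates of `g` in the family `1, a, w, aw`,
and of the reversed word `g'` in the family `1, a, w, wa`. -/
def HasCoords (g g' : FreeGroup (Fin 2)) (c : Fin 4 → MvPolynomial (Fin 3) ℂ) : Prop :=
  ∀ A B : Matrix.SpecialLinearGroup (Fin 2) ℂ,
    letI e := MvPolynomial.eval ![tr A, tr B, tr (A * B)]
    ↑ₘ(FreeGroup.lift ![A, B] g)
        = e (c 0) • 1 + e (c 1) • ↑ₘA + e (c 2) • ↑ₘB + e (c 3) • (↑ₘA * ↑ₘB) ∧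
    ↑ₘ(FreeGroup.lift ![A, B] g')
        = e (c 0) • 1 + e (c 1) • ↑ₘA + e (c 2) • ↑ₘB + e (c 3) • (↑ₘB * ↑ₘA)

open MvPolynomial in
lemma HasCoords.of_zero_mul {g g' : FreeGroup (Fin 2)} {c : Fin 4 → MvPolynomial (Fin 3) ℂ}
    (h : HasCoords g g' c) :
    HasCoords (FreeGroup.of 0 * g) (g' * FreeGroup.of 0)
      ![-c 1, c 0 + X 0 * c 1, -c 3, c 2 + X 0 * c 3] := by
  intro A B
  obtain ⟨h₁, h₂⟩ := h A B
  simp only [map_mul, Matrix.SpecialLinearGroup.coe_mul, h₁, h₂, FreeGroup.lift_apply_of]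
  constructor
  · simp [mul_add, ← mul_assoc, coe_mul_self A, sub_mul]
    module
  · simp [add_mul, mul_assoc, coe_mul_self A, mul_sub]
    module

open MvPolynomial in
lemma HasCoords.of_one_mul {g g' : FreeGroup (Fin 2)} {c : Fin 4 → MvPolynomial (Fin 3) ℂ}
    (h : HasCoords g g' c) :
    HasCoords (FreeGroup.of 1 * g) (g' * FreeGroup.of 1)
      ![(X 2 - X 0 * X 1) * c 1 - c 2 - X 0 * c 3, X 1 * c 1 + c 3,
        c 0 + X 0 * c 1 + X 1 * c 2 + X 2 * c 3, -c 1] := by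
  intro A B
  obtain ⟨h₁, h₂⟩ := h A B
  simp only [map_mul, Matrix.SpecialLinearGroup.coe_mul, h₁, h₂, FreeGroup.lift_apply_of]
  constructor
  · simp [mul_add, ← mul_assoc, coe_mul_mul_self A B, coe_mul_self B]
    rw [coe_mul_swap A B]
    module
  · simp [add_mul, coe_mul_mul_self A B, coe_mul_self B]
    rw [coe_mul_swap A B]
    module

open MvPolynomial in
/-- Coordinates of `a⁻¹ g`, from `a⁻¹ = tr a - a`. -/
lemma HasCoords.of_inv_mul {i : Fin 2} {g g' : FreeGroup (Fin 2)}
    {c d : Fin 4 → MvPolynomial (Fin 3) ℂ} (h : HasCoords g g' c)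
    (hd : HasCoords (FreeGroup.of i * g) (g' * FreeGroup.of i) d) :
    HasCoords ((FreeGroup.of i)⁻¹ * g) (g' * (FreeGroup.of i)⁻¹)
      (fun k => X i.castSucc * c k - d k) := by
  intro A B
  obtain ⟨h₁, h₂⟩ := h A B
  obtain ⟨h₃, h₄⟩ := hd A B
  simp only [map_mul, Matrix.SpecialLinearGroup.coe_mul] at h₃ h₄
  have hx : (![tr A, tr B, tr (A * B)] : Fin 3 → ℂ) i.castSucc = tr (![A, B] i) := by
    fin_cases i <;> rfl
  simp only [map_mul, map_inv, map_sub, Matrix.SpecialLinearGroup.coe_mul, FreeGroup.lift_apply_of,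
    coe_inv_eq, eval_X, hx] at h₃ h₄ ⊢
  rw [sub_mul, mul_sub, h₃, h₄, h₁, h₂]
  constructor
  · simp only [smul_mul_assoc, one_mul]
    module
  · simp only [mul_smul_comm, mul_one]
    module

/-- Every word has coordinates, shared with its reversal. -/
lemma exists_hasCoords {rev : FreeGroup (Fin 2) → FreeGroup (Fin 2)}
    (hrev_of : ∀ i : Fin 2, rev (FreeGroup.of i) = FreeGroup.of i)
    (hrev_mul : ∀ g h : FreeGroup (Fin 2), rev (g * h) = rev h * rev g)
    (g : FreeGroup (Fin 2)) : ∃ c, HasCoords g (rev g) c := by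
  have rev_one : rev 1 = 1 := by simpa using hrev_mul 1 1
  have rev_inv (x : FreeGroup (Fin 2)) : rev x⁻¹ = (rev x)⁻¹ :=
    eq_inv_of_mul_eq_one_left (by rw [← hrev_mul, mul_inv_cancel, rev_one])
  have of_mul (i : Fin 2) {h : FreeGroup (Fin 2)} {c} (hc : HasCoords h (rev h) c) :
      ∃ d, HasCoords (FreeGroup.of i * h) (rev h * FreeGroup.of i) d := by
    fin_cases i
    · exact ⟨_, hc.of_zero_mul⟩
    · exact ⟨_, hc.of_one_mul⟩
  have key : ∀ h, (∃ c, HasCoords h (rev h) c) → ∃ c, HasCoords (g * h) (rev (g * h)) c := by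
    induction g using FreeGroup.induction_on with
    | C1 => simp
    | of i =>
      rintro h ⟨c, hc⟩
      rw [hrev_mul, hrev_of]
      exact of_mul i hc
    | inv_of i _ =>
      rintro h ⟨c, hc⟩
      rw [hrev_mul, rev_inv, hrev_of]
      obtain ⟨d, hd⟩ := of_mul i hc
      exact ⟨_, hc.of_inv_mul hd⟩
    | mul x y hx hy =>
      intro h hh
      rw [mul_assoc]
      exact hx _ (hy _ hh)
  simpa using key 1 ⟨![1, 0, 0, 0], fun A B => by simp [rev_one]⟩

/-- The polynomial `x² + y² + z² - xyz - 4`, i.e. the trace of the commutator minus `2`. -/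
noncomputable def commutatorPoly : MvPolynomial (Fin 3) ℂ :=
  .X 0 ^ 2 + .X 1 ^ 2 + .X 2 ^ 2 - .X 0 * .X 1 * .X 2 - 4

section TracePolynomial

variable {P : FreeGroup (Fin 2) → MvPolynomial (Fin 3) ℂ}

/-- The difference of trace polynomials only involves the `aw`-coordinates. -/
lemma tracePoly_sub_eq
    (hP : ∀ (A B : Matrix.SpecialLinearGroup (Fin 2) ℂ) (g : FreeGroup (Fin 2)),
      MvPolynomial.eval ![tr A, tr B, tr (A * B)] (P g) = tr (FreeGroup.lift ![A, B] g))
    {r r' k k' : FreeGroup (Fin 2)} {c d : Fin 4 → MvPolynomial (Fin 3) ℂ}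
    (hr : HasCoords r r' c) (hk : HasCoords k k' d) :
    P (r * k) - P (r' * k) = c 3 * commutatorPoly * d 3 := by
  refine MvPolynomial.eq_of_eval_traces fun A B => ?_
  obtain ⟨h₁, h₂⟩ := hr A B
  obtain ⟨h₃, -⟩ := hk A B
  have hsub : ↑ₘ(FreeGroup.lift ![A, B] r) - ↑ₘ(FreeGroup.lift ![A, B] r')
      = MvPolynomial.eval ![tr A, tr B, tr (A * B)] (c 3) • (↑ₘA * ↑ₘB - ↑ₘB * ↑ₘA) := by
    rw [h₁, h₂]
    module
  have hA : Matrix.trace ((↑ₘA * ↑ₘB - ↑ₘB * ↑ₘA) * ↑ₘA) = 0 := by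
    rw [sub_mul, Matrix.trace_sub, Matrix.trace_mul_comm, mul_assoc, Matrix.trace_mul_comm ↑ₘB,
      mul_assoc, Matrix.trace_mul_comm ↑ₘA (↑ₘA * ↑ₘB), mul_assoc, Matrix.trace_mul_comm ↑ₘA,
      sub_self]
  have hB : Matrix.trace ((↑ₘA * ↑ₘB - ↑ₘB * ↑ₘA) * ↑ₘB) = 0 := by
    rw [sub_mul, Matrix.trace_sub, mul_assoc, mul_assoc, Matrix.trace_mul_comm ↑ₘB, mul_assoc,
      sub_self]
  have hAB : Matrix.trace ((↑ₘA * ↑ₘB - ↑ₘB * ↑ₘA) * (↑ₘA * ↑ₘB))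
      = MvPolynomial.eval ![tr A, tr B, tr (A * B)] commutatorPoly := by
    rw [sub_mul, Matrix.trace_sub, Matrix.trace_mul_comm (↑ₘB * ↑ₘA), trace_mul_mul_swap,
      ← Matrix.SpecialLinearGroup.coe_mul, trace_mul_self]
    simp [commutatorPoly]
    ring
  rw [map_sub, hP, hP, map_mul, map_mul, map_mul, map_mul, tr, tr,
    Matrix.SpecialLinearGroup.coe_mul, Matrix.SpecialLinearGroup.coe_mul,
    ← Matrix.trace_sub, ← sub_mul, hsub, h₃]
  simp only [smul_mul_assoc, mul_add, mul_smul_comm, Matrix.trace_smul, Matrix.trace_add,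
    hA, hB, hAB, mul_one, Matrix.trace_sub, Matrix.trace_mul_comm ↑ₘB ↑ₘA, smul_eq_mul]
  ring

lemma tracePoly_mul_comm
    (hP : ∀ (A B : Matrix.SpecialLinearGroup (Fin 2) ℂ) (g : FreeGroup (Fin 2)),
      MvPolynomial.eval ![tr A, tr B, tr (A * B)] (P g) = tr (FreeGroup.lift ![A, B] g))
    (g h : FreeGroup (Fin 2)) : P (g * h) = P (h * g) :=
  MvPolynomial.eq_of_eval_traces fun A B => by
    rw [hP, hP, map_mul, map_mul, tr, tr, Matrix.SpecialLinearGroup.coe_mul,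
      Matrix.SpecialLinearGroup.coe_mul, Matrix.trace_mul_comm]

/-- The elements whose left multiplication does not change trace polynomials modulo `I` form a
normal subgroup; hence membership of the relators propagates to their normal closure. -/
lemma tracePoly_sub_mem_of_mem_normalClosure
    (hcomm : ∀ g h, P (g * h) = P (h * g))
    (I : Ideal (MvPolynomial (Fin 3) ℂ)) {S : Set (FreeGroup (Fin 2))}
    (hS : ∀ s ∈ S, ∀ g, P (s * g) - P g ∈ I) {n : FreeGroup (Fin 2)}
    (hn : n ∈ Subgroup.normalClosure S) (g : FreeGroup (Fin 2)) : P (n * g) - P g ∈ I := by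
  induction hn using Subgroup.closure_induction generalizing g with
  | mem x hx =>
    obtain ⟨s, hs, hsx⟩ := Group.mem_conjugatesOfSet_iff.1 hx
    obtain ⟨k, rfl⟩ := isConj_iff.1 hsx
    have h := hS s hs (k⁻¹ * g * k)
    rwa [← mul_assoc, hcomm _ k, hcomm _ k,
      show k * (s * (k⁻¹ * g)) = k * s * k⁻¹ * g by group, mul_inv_cancel_left] at h
  | one => simp
  | mul x y _ _ hx hy =>
    have h := I.add_mem (hx (y * g)) (hy g)
    rwa [sub_add_sub_cancel, ← mul_assoc] at h
  | inv x _ hx =>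
    have h := I.neg_mem (hx (x⁻¹ * g))
    rwa [neg_sub, mul_inv_cancel_left] at h

end TracePolynomial

/-- Let `a`, `w` be the two generators of `F = FreeGroup (Fin 2)`, `rev` the word-reversal
anti-automorphism, `r ∈ F`, and `G` the presented group `⟨a, w ∣ r = rev r⟩` with projection
`π : F → G`.  Let `P` be the trace-polynomial map.  Then the ideal generated by all
differences `P u - P v` with `π u = π v` is the principal ideal generated by
`P (r*a*w) - P ((rev r)*a*w)`. -/
theorem universal_character_ring_principal
    (rev : FreeGroup (Fin 2) → FreeGroup (Fin 2))
    (hrev_of : ∀ i : Fin 2, rev (FreeGroup.of i) = FreeGroup.of i)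
    (hrev_mul : ∀ g h : FreeGroup (Fin 2), rev (g * h) = rev h * rev g)
    (r : FreeGroup (Fin 2))
    (P : FreeGroup (Fin 2) → MvPolynomial (Fin 3) ℂ)
    (hP : ∀ (A B : Matrix.SpecialLinearGroup (Fin 2) ℂ) (g : FreeGroup (Fin 2)),
      MvPolynomial.eval ![tr A, tr B, tr (A * B)] (P g) = tr (FreeGroup.lift ![A, B] g)) :
    letI a : FreeGroup (Fin 2) := FreeGroup.of 0
    letI w : FreeGroup (Fin 2) := FreeGroup.of 1
    Ideal.span {q : MvPolynomial (Fin 3) ℂ | ∃ u v : FreeGroup (Fin 2),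
        PresentedGroup.mk {r * (rev r)⁻¹} u = PresentedGroup.mk {r * (rev r)⁻¹} v ∧
        q = P u - P v}
      = Ideal.span {P (r * a * w) - P (rev r * a * w)} := by
  obtain ⟨c, hc⟩ := exists_hasCoords hrev_of hrev_mul r
  have haw : HasCoords (FreeGroup.of 0 * FreeGroup.of 1) (FreeGroup.of 1 * FreeGroup.of 0)
      ![0, 0, 0, 1] := fun A B => by simp
  have hgen : P (r * FreeGroup.of 0 * FreeGroup.of 1)
      - P (rev r * FreeGroup.of 0 * FreeGroup.of 1) = c 3 * commutatorPoly := by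
    rw [mul_assoc, mul_assoc, tracePoly_sub_eq hP hc haw]
    simp
  apply le_antisymm
  · rw [Ideal.span_le]
    rintro _ ⟨u, v, huv, rfl⟩
    have hn : u * v⁻¹ ∈ Subgroup.normalClosure {r * (rev r)⁻¹} := by
      rw [← PresentedGroup.mk_eq_one_iff, map_mul, map_inv, huv, mul_inv_cancel]
    have h := tracePoly_sub_mem_of_mem_normalClosure (tracePoly_mul_comm hP)
      (Ideal.span {c 3 * commutatorPoly}) ?_ hn v
    · rw [inv_mul_cancel_right] at h
      simpa only [hgen, SetLike.mem_coe] using h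
    · rintro _ rfl g
      obtain ⟨d, hd⟩ := exists_hasCoords hrev_of hrev_mul ((rev r)⁻¹ * g)
      have h := tracePoly_sub_eq hP hc hd
      rw [mul_inv_cancel_left, ← mul_assoc] at h
      rw [h]
      exact Ideal.mul_mem_right _ _ (Ideal.mem_span_singleton_self _)
  · rw [Ideal.span_singleton_le_iff_mem]
    refine Ideal.subset_span ⟨_, _, ?_, rfl⟩
    have h : PresentedGroup.mk {r * (rev r)⁻¹} (r * (rev r)⁻¹) = 1 :=
      PresentedGroup.one_of_mem rfl
    rw [map_mul, map_inv, mul_inv_eq_one] at h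
    simp only [map_mul, h]
end

section
/- Let a, w be the two generators of FreeGroup (Fin 2), let rev be the word-reversal anti-automorphism, and for an integer m let u := (a·w·a·w⁻¹)^(1−m) · w. Then rev u = u, i.e., u is a palindrome. -/
/-- A map of groups reversing products, as a homomorphism to the opposite group. -/
def antiHom {G H : Type*} [Group G] [Group H] (f : G → H)
    (hf : ∀ g h, f (g * h) = f h * f g) : G →* Hᵐᵒᵖ :=
  MonoidHom.mk' (fun g => MulOpposite.op (f g)) fun g h => by rw [hf, MulOpposite.op_mul]

theorem map_inv_of_anti {G H : Type*} [Group G] [Group H] {f : G → H}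
    (hf : ∀ g h, f (g * h) = f h * f g) (g : G) : f g⁻¹ = (f g)⁻¹ :=
  MulOpposite.op_injective (map_inv (antiHom f hf) g)

theorem map_zpow_of_anti {G H : Type*} [Group G] [Group H] {f : G → H}
    (hf : ∀ g h, f (g * h) = f h * f g) (g : G) (n : ℤ) : f (g ^ n) = f g ^ n :=
  MulOpposite.op_injective (map_zpow (antiHom f hf) g n)

/-- Let `a`, `w` be the two generators of `FreeGroup (Fin 2)`, `rev` the word-reversal
anti-automorphism, and `u := (a*w*a*w⁻¹)^(1-m) * w` for an integer `m`.
Then `rev u = u`, i.e. `u` is a palindrome. -/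
theorem palindrome_u (rev : FreeGroup (Fin 2) → FreeGroup (Fin 2))
    (hrev_of : ∀ i : Fin 2, rev (FreeGroup.of i) = FreeGroup.of i)
    (hrev_mul : ∀ g h : FreeGroup (Fin 2), rev (g * h) = rev h * rev g)
    (m : ℤ) :
    letI a : FreeGroup (Fin 2) := FreeGroup.of 0
    letI w : FreeGroup (Fin 2) := FreeGroup.of 1
    rev ((a * w * a * w⁻¹) ^ (1 - m) * w) = (a * w * a * w⁻¹) ^ (1 - m) * w := by
  have hsemi : SemiconjBy (FreeGroup.of (1 : Fin 2))
      ((FreeGroup.of 1)⁻¹ * (FreeGroup.of 0 * (FreeGroup.of 1 * FreeGroup.of 0)))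
      (FreeGroup.of 0 * FreeGroup.of 1 * FreeGroup.of 0 * (FreeGroup.of 1)⁻¹) := by
    simp [SemiconjBy, mul_assoc]
  simpa only [hrev_mul, map_zpow_of_anti hrev_mul, map_inv_of_anti hrev_mul, hrev_of]
    using (hsemi.zpow_right (1 - m)).eq
end

section
/- Fix integers m, n. For x, y, z ∈ ℂ define β := x·y·z + 2 − y² − z², α := y·S_{m−1}(β) − (x·z − y)·S_{m−2}(β), and Q(x,y,z) := (x·z − y)·S_{n−1}(α) − (S_m(β) − S_{m−1}(β))·S_{n−2}(α). Then for all x, y ∈ ℂ, Q(x, y, 0) = (−1)^((m−1)·(n−1)) · S_{2mn−2m−n−2}(y). -/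
open Polynomial

/-- The normalized Chebyshev polynomials `S k` (`k : ℤ`), determined by
`S 0 = 1`, `S 1 = X`, and the recurrence `S (k + 1) = X * S k - S (k - 1)` for all `k : ℤ`. -/
@[semireducible] noncomputable def chebS (R : Type*) [CommRing R] : ℤ → R[X]
  | 0 => 1
  | 1 => X
  | (n : ℕ) + 2 => X * chebS R (n + 1) - chebS R n
  | -((n : ℕ) + 1) => X * chebS R (-n) - chebS R (-n + 1)
  termination_by n => Int.natAbs n + Int.natAbs (n - 1)

/-- `β x y z = x*y*z + 2 - y² - z²`. -/
noncomputable def betaC (x y z : ℂ) : ℂ := x * y * z + 2 - y ^ 2 - z ^ 2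

/-- `α = y * S (m-1) (β) - (x*z - y) * S (m-2) (β)`. -/
noncomputable def alphaC (m : ℤ) (x y z : ℂ) : ℂ :=
  y * (chebS ℂ (m - 1)).eval (betaC x y z)
    - (x * z - y) * (chebS ℂ (m - 2)).eval (betaC x y z)

/-- `Q = (x*z - y) * S (n-1) (α) - (S m (β) - S (m-1) (β)) * S (n-2) (α)`. -/
noncomputable def QC (m n : ℤ) (x y z : ℂ) : ℂ :=
  (x * z - y) * (chebS ℂ (n - 1)).eval (alphaC m x y z)
    - ((chebS ℂ m).eval (betaC x y z) - (chebS ℂ (m - 1)).eval (betaC x y z))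
        * (chebS ℂ (n - 2)).eval (alphaC m x y z)

/-- A two-sided sequence satisfying `f (n + 2) = a * f (n + 1) - f n` is determined by its values
at `0` and `1`. -/
theorem eq_of_second_order_recurrence {R : Type*} [CommRing R] {a : R} {f g : ℤ → R}
    (hf : ∀ n, f (n + 2) = a * f (n + 1) - f n) (hg : ∀ n, g (n + 2) = a * g (n + 1) - g n)
    (h0 : f 0 = g 0) (h1 : f 1 = g 1) (n : ℤ) : f n = g n := by
  suffices h : f n = g n ∧ f (n + 1) = g (n + 1) from h.1
  induction n with
  | zero => exact ⟨h0, by simpa using h1⟩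
  | succ k ih =>
    refine ⟨ih.2, ?_⟩
    rw [show (k : ℤ) + 1 + 1 = k + 2 by ring, hf, hg, ih.1, ih.2]
  | pred k ih =>
    have hf' := hf (-(k : ℤ) - 1)
    have hg' := hg (-(k : ℤ) - 1)
    rw [show -(k : ℤ) - 1 + 2 = -k + 1 by ring, sub_add_cancel] at hf' hg'
    rw [sub_add_cancel]
    exact ⟨by linear_combination a * ih.1 - ih.2 + hf' - hg', ih.1⟩

theorem chebS_add_two (R : Type*) [CommRing R] :
    ∀ k : ℤ, chebS R (k + 2) = X * chebS R (k + 1) - chebS R k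
  | (k : ℕ) => chebS.eq_3 R k
  | -(k + 1 : ℕ) => by
    have h := chebS.eq_4 R k
    rw [show (-((k + 1 : ℕ) : ℤ)) + 2 = -k + 1 by push_cast; ring,
      show (-((k + 1 : ℕ) : ℤ)) + 1 = -k by push_cast; ring,
      show (-((k + 1 : ℕ) : ℤ)) = Int.negSucc k by rfl, h]
    ring

theorem chebS_eq_S (R : Type*) [CommRing R] (k : ℤ) : chebS R k = Chebyshev.S R k :=
  eq_of_second_order_recurrence (chebS_add_two R) (Chebyshev.S_add_two R)
    (by simp [chebS]) (by simp [chebS]) k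

section Chebyshev

variable {R : Type*} [CommRing R]

theorem eval_S_add_two (y : R) (k : ℤ) :
    (Chebyshev.S R (k + 2)).eval y
      = y * (Chebyshev.S R (k + 1)).eval y - (Chebyshev.S R k).eval y := by
  simp [Chebyshev.S_add_two]

theorem eval_S_add_four (y : R) (k : ℤ) :
    (Chebyshev.S R (k + 4)).eval y
      = (y ^ 2 - 2) * (Chebyshev.S R (k + 2)).eval y - (Chebyshev.S R k).eval y := by
  have h0 := eval_S_add_two y k
  have h1 := eval_S_add_two y (k + 1)
  have h2 := eval_S_add_two y (k + 2)
  ring_nf at h0 h1 h2 ⊢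
  linear_combination h2 + y * h1 + h0

theorem eval_S_neg_three (y : R) : (Chebyshev.S R (-3)).eval y = -y := by
  simpa using congrArg (eval y) (Chebyshev.S_neg R 3)

/-- The product formula `C k * S j = S (j + k) + S (j - k)`, with `C k = S k - S (k - 2)`. -/
theorem eval_S_add_add_eval_S_sub (y : R) (k j : ℤ) :
    (Chebyshev.S R (j + k)).eval y + (Chebyshev.S R (j - k)).eval y
      = ((Chebyshev.S R k).eval y - (Chebyshev.S R (k - 2)).eval y)
        * (Chebyshev.S R j).eval y := by
  refine eq_of_second_order_recurrence (a := y)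
    (f := fun j ↦ (Chebyshev.S R (j + k)).eval y + (Chebyshev.S R (j - k)).eval y)
    (g := fun j ↦ ((Chebyshev.S R k).eval y - (Chebyshev.S R (k - 2)).eval y)
        * (Chebyshev.S R j).eval y) (fun j ↦ ?_) (fun j ↦ ?_) ?_ ?_ j
  · have h1 := eval_S_add_two y (j + k)
    have h2 := eval_S_add_two y (j - k)
    ring_nf at h1 h2 ⊢
    linear_combination h1 + h2
  · linear_combination ((Chebyshev.S R k).eval y - (Chebyshev.S R (k - 2)).eval y)
      * eval_S_add_two y j
  · simp [Chebyshev.S_neg, sub_eq_add_neg]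
  · have h1 := eval_S_add_two y (k - 1)
    have h2 := eval_S_add_two y (k - 3)
    have h3 := congrArg (eval y) (Chebyshev.S_neg R (k - 1))
    simp only [eval_neg, Chebyshev.S_one, eval_X] at h3 ⊢
    ring_nf at h1 h2 h3 ⊢
    linear_combination h1 - h2 + h3

variable {K : Type*} [Field K]

theorem neg_one_zpow_add_one (k : ℤ) : (-1 : K) ^ (k + 1) = -(-1) ^ k := by
  rw [zpow_add_one₀ (by simp)]; ring

theorem mul_eval_S_add_eval_S_two_sub_sq (y : K) (m : ℤ) :
    y * ((Chebyshev.S K (m - 1)).eval (2 - y ^ 2) + (Chebyshev.S K (m - 2)).eval (2 - y ^ 2))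
      = (-1) ^ (m - 1)
        * ((Chebyshev.S K (2 * m - 1)).eval y - (Chebyshev.S K (2 * m - 1 - 2)).eval y) := by
  refine eq_of_second_order_recurrence (a := 2 - y ^ 2)
    (f := fun m ↦ y * ((Chebyshev.S K (m - 1)).eval (2 - y ^ 2)
      + (Chebyshev.S K (m - 2)).eval (2 - y ^ 2)))
    (g := fun m ↦ (-1) ^ (m - 1)
        * ((Chebyshev.S K (2 * m - 1)).eval y - (Chebyshev.S K (2 * m - 1 - 2)).eval y))
    (fun m ↦ ?_) (fun m ↦ ?_) ?_ ?_ m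
  · have h1 := eval_S_add_two (2 - y ^ 2) (m - 1)
    have h2 := eval_S_add_two (2 - y ^ 2) (m - 2)
    rw [show m - 1 + 2 = m + 2 - 1 by ring, show m - 1 + 1 = m + 1 - 1 by ring] at h1
    rw [show m - 2 + 2 = m + 2 - 2 by ring, show m - 2 + 1 = m + 1 - 2 by ring] at h2
    linear_combination y * (h1 + h2)
  · have h1 := eval_S_add_four y (2 * m - 1)
    have h2 := eval_S_add_four y (2 * m - 1 - 2)
    have e1 := neg_one_zpow_add_one (K := K) (m - 1)
    have e2 := neg_one_zpow_add_one (K := K) (m - 1 + 1)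
    rw [show 2 * m - 1 + 4 = 2 * (m + 2) - 1 by ring,
      show 2 * m - 1 + 2 = 2 * (m + 1) - 1 by ring] at h1
    rw [show 2 * m - 1 - 2 + 4 = 2 * (m + 2) - 1 - 2 by ring,
      show 2 * m - 1 - 2 + 2 = 2 * (m + 1) - 1 - 2 by ring] at h2
    rw [show m - 1 + 1 + 1 = m + 2 - 1 by ring, e1] at e2
    rw [show m - 1 + 1 = m + 1 - 1 by ring] at e1
    simp only [e1, e2]
    linear_combination (-1) ^ (m - 1) * (h1 - h2)
  · simp [eval_S_neg_three]
  · simp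

theorem eval_S_sub_eval_S_two_sub_sq (y : K) (m : ℤ) :
    (Chebyshev.S K m).eval (2 - y ^ 2) - (Chebyshev.S K (m - 1)).eval (2 - y ^ 2)
      = -((-1) ^ (m - 1) * (Chebyshev.S K (2 * m)).eval y) := by
  refine eq_of_second_order_recurrence (a := 2 - y ^ 2)
    (f := fun m ↦ (Chebyshev.S K m).eval (2 - y ^ 2)
      - (Chebyshev.S K (m - 1)).eval (2 - y ^ 2))
    (g := fun m ↦ -((-1) ^ (m - 1) * (Chebyshev.S K (2 * m)).eval y))
    (fun m ↦ ?_) (fun m ↦ ?_) ?_ ?_ m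
  · have h1 := eval_S_add_two (2 - y ^ 2) m
    have h2 := eval_S_add_two (2 - y ^ 2) (m - 1)
    rw [show m - 1 + 2 = m + 2 - 1 by ring, show m - 1 + 1 = m + 1 - 1 by ring] at h2
    linear_combination h1 - h2
  · have h1 := eval_S_add_four y (2 * m)
    have e1 := neg_one_zpow_add_one (K := K) (m - 1)
    have e2 := neg_one_zpow_add_one (K := K) (m - 1 + 1)
    rw [show 2 * m + 4 = 2 * (m + 2) by ring, show 2 * m + 2 = 2 * (m + 1) by ring] at h1
    rw [show m - 1 + 1 + 1 = m + 2 - 1 by ring, e1] at e2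
    rw [show m - 1 + 1 = m + 1 - 1 by ring] at e1
    simp only [e1, e2]
    linear_combination -(-1) ^ (m - 1) * h1
  · simp
  · simp [Chebyshev.S_two]; ring

/-- Composition of `S` with `ε * C k`, where `C k = S k - S (k - 2)` and `ε ^ 2 = 1`. -/
theorem eval_S_comp_sign_mul_C (y ε : K) (hε : ε * ε = 1) (k n : ℤ) :
    -y * (Chebyshev.S K (n - 1)).eval
          (ε * ((Chebyshev.S K k).eval y - (Chebyshev.S K (k - 2)).eval y))
        + ε * (Chebyshev.S K (k + 1)).eval y * (Chebyshev.S K (n - 2)).eval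
          (ε * ((Chebyshev.S K k).eval y - (Chebyshev.S K (k - 2)).eval y))
      = ε ^ (n - 1) * (Chebyshev.S K (k * (n - 1) - 3)).eval y := by
  have hε0 : ε ≠ 0 := left_ne_zero_of_mul_eq_one hε
  set c := (Chebyshev.S K k).eval y - (Chebyshev.S K (k - 2)).eval y with hc
  refine eq_of_second_order_recurrence (a := ε * c)
    (f := fun n ↦ -y * (Chebyshev.S K (n - 1)).eval (ε * c)
        + ε * (Chebyshev.S K (k + 1)).eval y * (Chebyshev.S K (n - 2)).eval (ε * c))
    (g := fun n ↦ ε ^ (n - 1) * (Chebyshev.S K (k * (n - 1) - 3)).eval y)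
    (fun n ↦ ?_) (fun n ↦ ?_) ?_ ?_ n
  · have h1 := eval_S_add_two (ε * c) (n - 1)
    have h2 := eval_S_add_two (ε * c) (n - 2)
    rw [show n - 1 + 2 = n + 2 - 1 by ring, show n - 1 + 1 = n + 1 - 1 by ring] at h1
    rw [show n - 2 + 2 = n + 2 - 2 by ring, show n - 2 + 1 = n + 1 - 2 by ring] at h2
    linear_combination -y * h1 + ε * (Chebyshev.S K (k + 1)).eval y * h2
  · have h := eval_S_add_add_eval_S_sub y k (k * (n + 1 - 1) - 3)
    rw [← hc, show k * (n + 1 - 1) - 3 + k = k * (n + 2 - 1) - 3 by ring,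
      show k * (n + 1 - 1) - 3 - k = k * (n - 1) - 3 by ring] at h
    have e1 : ε ^ (n + 1 - 1) = ε ^ (n - 1) * ε := by
      rw [← zpow_add_one₀ hε0]; congr 1; ring
    have e2 : ε ^ (n + 2 - 1) = ε ^ (n - 1) := by
      rw [show n + 2 - 1 = n - 1 + 1 + 1 by ring, zpow_add_one₀ hε0, zpow_add_one₀ hε0, mul_assoc,
        hε, mul_one]
    simp only [e1, e2]
    linear_combination ε ^ (n - 1) * h
      - ε ^ (n - 1) * c * (Chebyshev.S K (k * (n + 1 - 1) - 3)).eval y * hε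
  · have hinv : ε⁻¹ = ε := inv_eq_of_mul_eq_one_left hε
    have h1 := congrArg (eval y) (Chebyshev.S_neg_sub_two K (k + 1))
    rw [show -(k + 1) - 2 = k * (0 - 1) - 3 by ring, eval_neg] at h1
    simp only [h1]
    simp [hinv]
  · simp [eval_S_neg_three]

end Chebyshev

/-- `Q (x, y, 0) = (-1)^((m-1)(n-1)) * S (2mn - 2m - n - 2) (y)`. -/
theorem Q_at_z_eq_zero (m n : ℤ) (x y : ℂ) :
    QC m n x y 0
      = (-1 : ℂ) ^ ((m - 1) * (n - 1)) * (chebS ℂ (2 * m * n - 2 * m - n - 2)).eval y := by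
  have hε : (-1 : ℂ) ^ (m - 1) * (-1) ^ (m - 1) = 1 := by
    rw [← mul_zpow]; simp
  have hβ : betaC x y 0 = 2 - y ^ 2 := by simp [betaC]
  have hα : alphaC m x y 0 = (-1) ^ (m - 1)
      * ((Chebyshev.S ℂ (2 * m - 1)).eval y - (Chebyshev.S ℂ (2 * m - 1 - 2)).eval y) := by
    rw [← mul_eval_S_add_eval_S_two_sub_sq, alphaC, hβ, chebS_eq_S, chebS_eq_S]
    ring
  have h := eval_S_comp_sign_mul_C y _ hε (2 * m - 1) n
  rw [← hα, ← zpow_mul, sub_add_cancel,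
    show (2 * m - 1) * (n - 1) - 3 = 2 * m * n - 2 * m - n - 2 by ring] at h
  simp only [QC, hβ, chebS_eq_S]
  rw [eval_S_sub_eval_S_two_sub_sq, ← h]
  ring
end
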